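/- Let a, b > 0, N, M ∈ ℕ and 0 ≤ ν ≤ 1. Set α = ⌊2^{N}ν⌋ + 1 − 2^{N}ν, x = (a^{⌊2^{N}ν⌋} b^{2^{N}−⌊2^{N}ν⌋})^{1/2^{N}} and y = (a^{⌊2^{N}ν⌋+1} b^{2^{N}−⌊2^{N}ν⌋−1})^{1/2^{N}}. Then a^ν b^{1−ν} + S_N(ν; a, b) + S_M(α; x, y) ≤ ν a + (1−ν) b. -/

import Mathlib

open Real Finset

noncomputable def kj (j : ℕ) (ν : ℝ) : ℤ := ⌊(2:ℝ)^(j-1) * ν⌋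

noncomputable def rj (j : ℕ) (ν : ℝ) : ℤ := ⌊(2:ℝ)^j * ν⌋

noncomputable def sj (j : ℕ) (ν : ℝ) : ℝ :=
  (-1:ℝ)^(rj j ν) * (2:ℝ)^(j-1) * ν
    + (-1:ℝ)^(rj j ν + 1) * (⌊((rj j ν : ℝ) + 1)/2⌋ : ℤ)

noncomputable def SS (N : ℕ) (ν a b : ℝ) : ℝ :=
  ∑ j ∈ Finset.Icc 1 N, sj j ν *
    ((b ^ ((2:ℝ)^(j-1) - (kj j ν : ℝ)) * a ^ ((kj j ν : ℝ))) ^ ((1:ℝ)/2^j)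
      - (a ^ ((kj j ν : ℝ) + 1) * b ^ ((2:ℝ)^(j-1) - (kj j ν : ℝ) - 1)) ^ ((1:ℝ)/2^j))^2

/-- The weighted geometric mean `a ^ t * b ^ (1 - t)`, written through the exponential. -/
noncomputable def geomInterp (a b t : ℝ) : ℝ := exp (t * log a + (1 - t) * log b)

lemma rpow_mul_rpow_rpow_one_div {a b c : ℝ} (ha : 0 < a) (hb : 0 < b) (hc : c ≠ 0)
    {p q d : ℝ} (hpq : p + q = d) :
    (a ^ p * b ^ q) ^ (1 / c) = exp ((p * log a + (d - p) * log b) / c) := by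
  subst hpq
  rw [rpow_def_of_pos ha, rpow_def_of_pos hb, ← exp_add, ← exp_mul]
  congr 1
  field_simp
  ring

lemma rpow_mul_rpow_rpow_one_div_two_pow {a b : ℝ} (ha : 0 < a) (hb : 0 < b) (N : ℕ)
    {p q : ℝ} (hpq : p + q = 2 ^ N) :
    (a ^ p * b ^ q) ^ ((1:ℝ) / 2 ^ N) = geomInterp a b (p / 2 ^ N) := by
  have h : (2:ℝ) ^ N ≠ 0 := by positivity
  rw [rpow_mul_rpow_rpow_one_div ha hb h hpq, geomInterp]
  congr 1
  field_simp

lemma rpow_mul_rpow_rpow_one_div_two_pow_succ {a b : ℝ} (ha : 0 < a) (hb : 0 < b) (N : ℕ)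
    {p q : ℝ} (hpq : p + q = 2 ^ N) :
    (a ^ p * b ^ q) ^ ((1:ℝ) / 2 ^ (N + 1)) = exp ((p / 2 ^ N * log a
      + (1 - p / 2 ^ N) * log b) / 2) := by
  have h : (2:ℝ) ^ (N + 1) ≠ 0 := by positivity
  rw [rpow_mul_rpow_rpow_one_div ha hb h hpq]
  congr 1
  rw [pow_succ]
  field_simp

/-- The piecewise linear interpolation of `geomInterp a b` at the dyadic points of level `N`. -/
noncomputable def dyadicInterp (N : ℕ) (ν a b : ℝ) : ℝ :=
  ((⌊(2:ℝ) ^ N * ν⌋ : ℝ) + 1 - 2 ^ N * ν) * geomInterp a b (⌊(2:ℝ) ^ N * ν⌋ / 2 ^ N)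
    + (2 ^ N * ν - ⌊(2:ℝ) ^ N * ν⌋) * geomInterp a b ((⌊(2:ℝ) ^ N * ν⌋ + 1) / 2 ^ N)

lemma dyadicInterp_zero {ν a b : ℝ} (ha : 0 < a) (hb : 0 < b) (h0 : 0 ≤ ν) (h1 : ν ≤ 1) :
    dyadicInterp 0 ν a b = ν * a + (1 - ν) * b := by
  rcases h1.eq_or_lt with rfl | h1
  · simp [dyadicInterp, geomInterp, exp_log ha]
  · have h : ⌊ν⌋ = 0 := Int.floor_eq_zero_iff.2 ⟨h0, h1⟩
    simp [dyadicInterp, geomInterp, h, exp_log ha, exp_log hb]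
    ring

lemma SS_succ (N : ℕ) (ν a b : ℝ) : SS (N + 1) ν a b = SS N ν a b + sj (N + 1) ν *
    ((b ^ ((2:ℝ) ^ N - (⌊(2:ℝ) ^ N * ν⌋ : ℝ)) * a ^ (⌊(2:ℝ) ^ N * ν⌋ : ℝ)) ^ ((1:ℝ) / 2 ^ (N + 1))
      - (a ^ ((⌊(2:ℝ) ^ N * ν⌋ : ℝ) + 1) * b ^ ((2:ℝ) ^ N - (⌊(2:ℝ) ^ N * ν⌋ : ℝ) - 1))
        ^ ((1:ℝ) / 2 ^ (N + 1))) ^ 2 := by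
  rw [SS, Finset.sum_Icc_succ_top (by omega)]
  rfl

lemma sj_of_rj_eq_two_mul {j : ℕ} {ν : ℝ} {k : ℤ} (h : rj j ν = 2 * k) :
    sj j ν = 2 ^ (j - 1) * ν - k := by
  have hf : ⌊((2 * k : ℝ) + 1) / 2⌋ = k := by
    rw [Int.floor_eq_iff]; constructor <;> linarith
  rw [sj, h, (even_two_mul k).neg_one_zpow, (even_two_mul k).add_one.neg_one_zpow]
  push_cast
  rw [hf]
  ring

lemma sj_of_rj_eq_two_mul_add_one {j : ℕ} {ν : ℝ} {k : ℤ} (h : rj j ν = 2 * k + 1) :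
    sj j ν = k + 1 - 2 ^ (j - 1) * ν := by
  have hf : ⌊((2 * k + 1 : ℝ) + 1) / 2⌋ = k + 1 := by
    rw [Int.floor_eq_iff]; push_cast; constructor <;> linarith
  rw [sj, h, (even_two_mul k).add_one.neg_one_zpow,
    (even_two_mul k).add_one.add_one.neg_one_zpow]
  push_cast
  rw [hf]
  push_cast
  ring

lemma dyadicInterp_succ_add {a b : ℝ} (ha : 0 < a) (hb : 0 < b) (N : ℕ) (ν : ℝ) :
    dyadicInterp (N + 1) ν a b + (SS (N + 1) ν a b - SS N ν a b) = dyadicInterp N ν a b := by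
  rw [SS_succ, mul_comm (b ^ _) (a ^ _),
    rpow_mul_rpow_rpow_one_div_two_pow_succ ha hb N (by ring),
    rpow_mul_rpow_rpow_one_div_two_pow_succ ha hb N (by ring)]
  have hlo := Int.floor_le ((2:ℝ) ^ N * ν)
  have hhi := Int.lt_floor_add_one ((2:ℝ) ^ N * ν)
  have hN : (2:ℝ) ^ N ≠ 0 := by positivity
  unfold dyadicInterp
  set k := ⌊(2:ℝ) ^ N * ν⌋
  set u := exp (((k:ℝ) / 2 ^ N * log a + (1 - (k:ℝ) / 2 ^ N) * log b) / 2) with hu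
  set v := exp ((((k:ℝ) + 1) / 2 ^ N * log a + (1 - ((k:ℝ) + 1) / 2 ^ N) * log b) / 2) with hv
  have hu2 : geomInterp a b (k / 2 ^ N) = u ^ 2 := by
    rw [geomInterp, hu, ← exp_nat_mul]; congr 1; push_cast; ring
  have hv2 : geomInterp a b ((k + 1) / 2 ^ N) = v ^ 2 := by
    rw [geomInterp, hv, ← exp_nat_mul]; congr 1; push_cast; ring
  have huv : geomInterp a b ((2 * k + 1) / 2 ^ (N + 1)) = u * v := by
    rw [geomInterp, hu, hv, ← exp_add]; congr 1; rw [pow_succ]; field_simp; ring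
  have hl : geomInterp a b (2 * k / 2 ^ (N + 1)) = u ^ 2 := by
    rw [← hu2]; congr 1; rw [pow_succ]; field_simp
  have hr : geomInterp a b ((2 * k + 1 + 1) / 2 ^ (N + 1)) = v ^ 2 := by
    rw [← hv2]; congr 1; rw [pow_succ]; field_simp; ring
  have hpow : (2:ℝ) ^ (N + 1) * ν = 2 * (2 ^ N * ν) := by ring
  rcases lt_or_ge ((2:ℝ) ^ N * ν) (k + 1 / 2) with h | h
  · have hf : ⌊(2:ℝ) ^ (N + 1) * ν⌋ = 2 * k := by
      rw [Int.floor_eq_iff, hpow]; push_cast; constructor <;> linarith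
    rw [sj_of_rj_eq_two_mul hf, hf, hu2, hv2, Nat.add_sub_cancel]
    push_cast
    rw [hl, huv, hpow]
    ring
  · have hf : ⌊(2:ℝ) ^ (N + 1) * ν⌋ = 2 * k + 1 := by
      rw [Int.floor_eq_iff, hpow]; push_cast; constructor <;> linarith
    rw [sj_of_rj_eq_two_mul_add_one hf, hf, hu2, hv2, Nat.add_sub_cancel]
    push_cast
    rw [hr, huv, hpow]
    ring

lemma dyadicInterp_add_SS {a b ν : ℝ} (ha : 0 < a) (hb : 0 < b) (h0 : 0 ≤ ν) (h1 : ν ≤ 1)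
    (N : ℕ) : dyadicInterp N ν a b + SS N ν a b = ν * a + (1 - ν) * b := by
  induction N with
  | zero => simp [SS, dyadicInterp_zero ha hb h0 h1]
  | succ N ih => linarith [dyadicInterp_succ_add ha hb N ν]

lemma geomInterp_le_dyadicInterp (N : ℕ) (ν a b : ℝ) :
    geomInterp a b ν ≤ dyadicInterp N ν a b := by
  have hlo := Int.floor_le ((2:ℝ) ^ N * ν)
  have hhi := Int.lt_floor_add_one ((2:ℝ) ^ N * ν)
  have hN : (2:ℝ) ^ N ≠ 0 := by positivity
  unfold dyadicInterp
  set k := ⌊(2:ℝ) ^ N * ν⌋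
  refine le_trans (le_of_eq ?_) (geom_mean_le_arith_mean2_weighted (by linarith) (by linarith)
    (exp_pos _).le (exp_pos _).le (by ring))
  unfold geomInterp
  rw [← exp_mul, ← exp_mul, ← exp_add]
  congr 1
  field_simp
  ring

theorem stmt8 (a b ν : ℝ) (ha : 0 < a) (hb : 0 < b) (N M : ℕ) (h0 : 0 ≤ ν) (h1 : ν ≤ 1) :
    a ^ ν * b ^ (1 - ν) + SS N ν a b
      + SS M ((⌊(2:ℝ)^N * ν⌋ : ℝ) + 1 - (2:ℝ)^N * ν)
          ((a ^ ((⌊(2:ℝ)^N * ν⌋ : ℝ)) * b ^ ((2:ℝ)^N - (⌊(2:ℝ)^N * ν⌋ : ℝ))) ^ ((1:ℝ)/2^N))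
          ((a ^ ((⌊(2:ℝ)^N * ν⌋ : ℝ) + 1)
              * b ^ ((2:ℝ)^N - (⌊(2:ℝ)^N * ν⌋ : ℝ) - 1)) ^ ((1:ℝ)/2^N))
      ≤ ν * a + (1 - ν) * b := by
  rw [rpow_mul_rpow_rpow_one_div_two_pow ha hb N (by ring),
    rpow_mul_rpow_rpow_one_div_two_pow ha hb N (by ring)]
  have hlo := Int.floor_le ((2:ℝ) ^ N * ν)
  have hhi := Int.lt_floor_add_one ((2:ℝ) ^ N * ν)
  have hN : (2:ℝ) ^ N ≠ 0 := by positivity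
  have hab := dyadicInterp_add_SS ha hb h0 h1 N
  unfold dyadicInterp at hab
  set k := ⌊(2:ℝ) ^ N * ν⌋
  set x := geomInterp a b (k / 2 ^ N) with hx
  set y := geomInterp a b ((k + 1) / 2 ^ N) with hy
  have hxy := dyadicInterp_add_SS (a := x) (b := y) (ν := k + 1 - 2 ^ N * ν)
    (exp_pos _) (exp_pos _) (by linarith) (by linarith) M
  have hle := geomInterp_le_dyadicInterp M (k + 1 - 2 ^ N * ν) x y
  have hgeom : geomInterp x y (k + 1 - 2 ^ N * ν) = a ^ ν * b ^ (1 - ν) := by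
    rw [rpow_def_of_pos ha, rpow_def_of_pos hb, ← exp_add, hx, hy]
    unfold geomInterp
    rw [log_exp, log_exp]
    congr 1
    field_simp
    ring
  linarith
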